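/- arXiv:2510.25789 — 2 statements merged into one kernel-verified Lean document; each statement's English description precedes it below -/
import Mathlib

section
/- Let (W, Σ_W, μ) be a σ-finite positive measure space and (Z, Σ_Z) a measurable space. If f : W×Z → ℂ is measurable (with respect to the product σ-algebra), then the function g : Z → [0,∞] defined by g(z) = ‖f(·,z)‖_{L∞(μ)} (the μ-essential supremum of |f(·,z)|) is measurable. -/
open MeasureTheory

noncomputable section

namespace DOI

/-- If `(W, μ)` is a σ-finite measure space and `f : W × Z → ℂ` is measurable, then
`z ↦ ‖f(·,z)‖_{L^∞(μ)}` (the `μ`-essential supremum of `|f(·,z)|`) is measurable. -/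
theorem statement12 {W Z : Type*} [MeasurableSpace W] [MeasurableSpace Z]
    (μ : Measure W) [SigmaFinite μ] (f : W × Z → ℂ) (hf : Measurable f) :
    Measurable fun z => eLpNorm (fun w => f (w, z)) ⊤ μ := by
  refine measurable_of_Iic fun c => ?_
  have hsub : MeasurableSet {p : W × Z | c < ‖f p‖ₑ} :=
    measurableSet_lt measurable_const hf.enorm
  have hpre : (fun z => eLpNorm (fun w => f (w, z)) ⊤ μ) ⁻¹' Set.Iic c =
      (fun z => μ ((fun w => (w, z)) ⁻¹' {p : W × Z | c < ‖f p‖ₑ})) ⁻¹' {0} := by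
    ext z
    have hae : eLpNorm (fun w => f (w, z)) ⊤ μ ≤ c ↔ ∀ᵐ w ∂μ, ‖f (w, z)‖ₑ ≤ c := by
      rw [eLpNorm_exponent_top]
      exact ⟨fun h => ae_le_eLpNormEssSup.mono fun _ hw => hw.trans h, essSup_le_of_ae_le c⟩
    simpa [ae_iff] using hae
  rw [hpre]
  exact measurable_measure_prodMk_right hsub (measurableSet_singleton 0)

end DOI
end
end

section
/- Let λ and μ be σ-finite positive measures on measurable spaces X and Y respectively, let f : X → ℂ and g : Y → ℂ be measurable, and let h : X×Y → ℂ be h(x,y) = f(x)g(y). Then the essential range of h with respect to λ×μ contains {ab : a ∈ essran f, b ∈ essran g}, and ‖h‖_{L∞(λ×μ)} = ‖f‖_{L∞(λ)} · ‖g‖_{L∞(μ)} (with the convention that this equality holds in [0,∞]). -/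
open MeasureTheory
open scoped ENNReal

noncomputable section

namespace DOI

/-- The essential range of a function `f` with respect to a measure `μ`: the set of points
all of whose neighborhoods have preimage of positive measure. -/
def essRange {X : Type*} [MeasurableSpace X] (μ : Measure X) (f : X → ℂ) : Set ℂ :=
  {b | ∀ U ∈ nhds b, 0 < μ (f ⁻¹' U)}

/-- A product of points of the essential ranges lies in the essential range of the product. -/
theorem mul_mem_essRange_prod {X Y : Type*} [MeasurableSpace X] [MeasurableSpace Y]
    {μ : Measure X} {ν : Measure Y} [SFinite ν] {f : X → ℂ} {g : Y → ℂ} {a b : ℂ}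
    (ha : a ∈ essRange μ f) (hb : b ∈ essRange ν g) :
    a * b ∈ essRange (μ.prod ν) (fun p => f p.1 * g p.2) := by
  intro U hU
  have hmul : (fun p : ℂ × ℂ => p.1 * p.2) ⁻¹' U ∈ nhds (a, b) :=
    (continuous_mul.tendsto (a, b)) hU
  obtain ⟨V, hV, W, hW, hVW⟩ := mem_nhds_prod_iff.mp hmul
  calc 0 < μ (f ⁻¹' V) * ν (g ⁻¹' W) := ENNReal.mul_pos (ha V hV).ne' (hb W hW).ne'
    _ = μ.prod ν ((f ⁻¹' V) ×ˢ (g ⁻¹' W)) := (Measure.prod_prod _ _).symm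
    _ ≤ μ.prod ν ((fun p => f p.1 * g p.2) ⁻¹' U) :=
      measure_mono fun p hp => hVW (Set.mk_mem_prod hp.1 hp.2)

/-- The essential supremum of a product of functions of separate variables is the product of the
essential suprema. -/
theorem essSup_prod_mul {X Y : Type*} [MeasurableSpace X] [MeasurableSpace Y]
    (μ : Measure X) (ν : Measure Y) [SFinite ν] (u : X → ℝ≥0∞) (v : Y → ℝ≥0∞) :
    essSup (fun p : X × Y => u p.1 * v p.2) (μ.prod ν) = essSup u μ * essSup v ν := by
  apply le_antisymm
  · refine essSup_le_of_ae_le _ ?_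
    filter_upwards [Measure.quasiMeasurePreserving_fst.ae (ENNReal.ae_le_essSup u),
      Measure.quasiMeasurePreserving_snd.ae (ENNReal.ae_le_essSup v)] with p hu hv
    exact mul_le_mul' hu hv
  · rw [mul_comm, ← ENNReal.essSup_const_mul]
    refine essSup_le_of_ae_le _ ?_
    filter_upwards [Measure.ae_ae_of_ae_prod
      (ENNReal.ae_le_essSup (μ := μ.prod ν) fun p : X × Y => u p.1 * v p.2)] with x hx
    rw [mul_comm, ← ENNReal.essSup_const_mul]
    exact essSup_le_of_ae_le _ hx

/-- For σ-finite measures `λ, μ` and measurable `f, g`, the essential range of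
`h(x,y) = f(x)g(y)` contains all products of points of the essential ranges of `f` and `g`,
and `‖h‖_{L^∞(λ×μ)} = ‖f‖_{L^∞(λ)} ‖g‖_{L^∞(μ)}` (in `[0,∞]`). -/
theorem statement13 {X Y : Type*} [MeasurableSpace X] [MeasurableSpace Y]
    (lam : Measure X) (mu : Measure Y) [SigmaFinite lam] [SigmaFinite mu]
    (f : X → ℂ) (g : Y → ℂ) (hf : Measurable f) (hg : Measurable g) :
    ({c : ℂ | ∃ a ∈ essRange lam f, ∃ b ∈ essRange mu g, c = a * b} ⊆
      essRange (lam.prod mu) (fun p => f p.1 * g p.2)) ∧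
    eLpNorm (fun p : X × Y => f p.1 * g p.2) ⊤ (lam.prod mu) =
      eLpNorm f ⊤ lam * eLpNorm g ⊤ mu := by
  refine ⟨?_, ?_⟩
  · rintro _ ⟨a, ha, b, hb, rfl⟩
    exact mul_mem_essRange_prod ha hb
  · simp only [eLpNorm_exponent_top, eLpNormEssSup, enorm_mul]
    exact essSup_prod_mul lam mu (fun x => ‖f x‖ₑ) (fun y => ‖g y‖ₑ)

end DOI
end
end
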